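/- Let m, n be positive integers and ρ a faithful positive linear functional on M_n(ℂ). Then K_{m,ρ} is the closed convex hull (in the product topology) of exr(K_{m,ρ}), the union of its extreme rays. (Lemma 3.1 of the paper.) -/

import Mathlib

open scoped ComplexOrder

namespace DeFinetti

/-- `M_m(ℂ) ⊗ M_n(ℂ)^{⊗ l}`, realized as complex matrices indexed by
`Fin m × (Fin l → Fin n)`. -/
abbrev Mat (m n l : ℕ) : Type :=
  Matrix (Fin m × (Fin l → Fin n)) (Fin m × (Fin l → Fin n)) ℂ

/-- Invariance under the action of `S_l` simultaneously permuting the `l`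
tensor-factor positions of row and column indices. -/
def SymInvariant {m n l : ℕ} (x : Mat m n l) : Prop :=
  ∀ σ : Equiv.Perm (Fin l), ∀ p q : Fin m, ∀ i j : Fin l → Fin n,
    x (p, i ∘ σ) (q, j ∘ σ) = x (p, i) (q, j)

/-- The slice map `id_m ⊗ id_n^{⊗l} ⊗ ν` applying the functional `ν` to the
last tensor factor. -/
def sliceMap {m n l : ℕ} (ν : Matrix (Fin n) (Fin n) ℂ →ₗ[ℂ] ℂ)
    (y : Mat m n (l + 1)) : Mat m n l :=
  fun pi qj =>
    ν (Matrix.of fun s t => y (pi.1, Fin.snoc pi.2 s) (qj.1, Fin.snoc qj.2 t))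

/-- A positive linear functional on `M_n(ℂ)`. -/
def IsPosLF {n : ℕ} (ρ : Matrix (Fin n) (Fin n) ℂ →ₗ[ℂ] ℂ) : Prop :=
  ∀ x : Matrix (Fin n) (Fin n) ℂ, x.PosSemidef → 0 ≤ ρ x

/-- A faithful positive linear functional on `M_n(ℂ)`. -/
def IsFaithfulPosLF {n : ℕ} (ρ : Matrix (Fin n) (Fin n) ℂ →ₗ[ℂ] ℂ) : Prop :=
  IsPosLF ρ ∧ ∀ x : Matrix (Fin n) (Fin n) ℂ, x.PosSemidef → x ≠ 0 → 0 < ρ x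

/-- The convex cone `K_{m,ρ}` of sub-martingale sequences of symmetric quantum
states. -/
def Kcone (m n : ℕ) (ρ : Matrix (Fin n) (Fin n) ℂ →ₗ[ℂ] ℂ) :
    Set (∀ l : ℕ, Mat m n l) :=
  { x | (∀ l, (x l).PosSemidef) ∧ (∀ l, SymInvariant (x l)) ∧
        ∀ l, (x l - sliceMap ρ (x (l + 1))).PosSemidef }

section ExtremeRays

variable {E : Type*} [AddCommGroup E] [Module ℝ E]

/-- `x` lies on the ray `ℝ≥0 • v`. -/
def OnRay (v x : E) : Prop := ∃ r : ℝ, 0 ≤ r ∧ x = r • v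

/-- `v` generates an extreme ray of the convex cone `K`. -/
def IsExtremeRayGen (K : Set E) (v : E) : Prop :=
  v ∈ K ∧ v ≠ 0 ∧
    ∀ x : E, OnRay v x → x ≠ 0 →
      ∀ y ∈ K, ∀ z ∈ K, ∀ t : ℝ, 0 < t → t < 1 →
        x = t • y + (1 - t) • z → OnRay v y ∧ OnRay v z

/-- `exr K`: the union of the extreme rays of `K`. -/
def exr (K : Set E) : Set E := { x | ∃ v : E, IsExtremeRayGen K v ∧ OnRay v x }

end ExtremeRays

/-- The Kronecker product `a ⊗ b^{⊗ l}`. -/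
def kronPow {m n : ℕ} (a : Matrix (Fin m) (Fin m) ℂ) (b : Matrix (Fin n) (Fin n) ℂ)
    (l : ℕ) : Mat m n l :=
  fun pi qj => a pi.1 qj.1 * ∏ k : Fin l, b (pi.2 k) (qj.2 k)

/-- The tensor power functional `ρ^{⊗ k}`, obtained by iterating the slice of
the last factor. -/
def powFun {n : ℕ} (ρ : Matrix (Fin n) (Fin n) ℂ →ₗ[ℂ] ℂ) :
    (k : ℕ) → Matrix (Fin k → Fin n) (Fin k → Fin n) ℂ → ℂ
  | 0, z => z (fun i => i.elim0) (fun i => i.elim0)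
  | k + 1, z => powFun ρ k (Matrix.of fun i j =>
      ρ (Matrix.of fun s t => z (Fin.snoc i s) (Fin.snoc j t)))

/-- `(id_m ⊗ id_n ⊗ ρ^{⊗ k})(y)` for `y ∈ M_m(ℂ) ⊗ M_n(ℂ)^{⊗ (k+1)}`,
applying `ρ^{⊗ k}` to the last `k` tensor factors. -/
def subSlice {m n : ℕ} (ρ : Matrix (Fin n) (Fin n) ℂ →ₗ[ℂ] ℂ) {k : ℕ}
    (y : Mat m n (k + 1)) : Matrix (Fin m × Fin n) (Fin m × Fin n) ℂ :=
  fun ps qt => powFun ρ k (Matrix.of fun i j =>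
    y (ps.1, Fin.cons ps.2 i) (qt.1, Fin.cons qt.2 j))

/-- `y` is an `(k+1)`-sub-extension of `a` with respect to `ρ`. -/
def IsSubExtension {m n : ℕ} (ρ : Matrix (Fin n) (Fin n) ℂ →ₗ[ℂ] ℂ)
    (a : Matrix (Fin m × Fin n) (Fin m × Fin n) ℂ) {k : ℕ}
    (y : Mat m n (k + 1)) : Prop :=
  y.PosSemidef ∧ SymInvariant y ∧ (a - subSlice ρ y).PosSemidef

/-- Separability: `a` is a finite sum of Kronecker products of positive
semidefinite matrices. -/
def IsSeparable {m n : ℕ} (a : Matrix (Fin m × Fin n) (Fin m × Fin n) ℂ) : Prop :=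
  ∃ (N : ℕ) (b : Fin N → Matrix (Fin m) (Fin m) ℂ)
    (c : Fin N → Matrix (Fin n) (Fin n) ℂ),
    (∀ i, (b i).PosSemidef) ∧ (∀ i, (c i).PosSemidef) ∧
    a = ∑ i, Matrix.kroneckerMap (· * ·) (b i) (c i)


section ConeWithCompactBase

variable {E : Type*} [AddCommGroup E] [Module ℝ E]

/-- An extreme point of the base `{x ∈ K | f x = 1}` of a cone generates an extreme ray. -/
theorem isExtremeRayGen_of_mem_extremePoints {K : Set E}
    (hsmul : ∀ x ∈ K, ∀ r : ℝ, 0 ≤ r → r • x ∈ K)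
    {f : E →ₗ[ℝ] ℝ} (hf : ∀ x ∈ K, x ≠ 0 → 0 < f x) {b : E}
    (hb : b ∈ {x | x ∈ K ∧ f x = 1}.extremePoints ℝ) : IsExtremeRayGen K b := by
  obtain ⟨⟨hbK, hb1⟩, hbext⟩ := hb
  refine ⟨hbK, fun h => by simp [h] at hb1, ?_⟩
  rintro x ⟨r, hr, rfl⟩ hx y hy z hz t ht0 ht1 hxyz
  have hr0 : r ≠ 0 := fun h => hx (by simp [h])
  have hrpos : 0 < r := lt_of_le_of_ne hr hr0.symm
  have ht1' : 0 < 1 - t := sub_pos.2 ht1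
  by_cases hy0 : y = 0
  · subst hy0
    refine ⟨⟨0, le_rfl, by simp⟩, ⟨(1 - t)⁻¹ * r, by positivity, ?_⟩⟩
    rw [mul_smul, hxyz]
    simp [smul_smul, ht1'.ne']
  by_cases hz0 : z = 0
  · subst hz0
    refine ⟨⟨t⁻¹ * r, by positivity, ?_⟩, ⟨0, le_rfl, by simp⟩⟩
    rw [mul_smul, hxyz]
    simp [smul_smul, ht0.ne']
  have hfy := hf y hy hy0
  have hfz := hf z hz hz0
  have hsum : r = t * f y + (1 - t) * f z := by
    have := congrArg f hxyz
    simpa [hb1] using this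
  have hseg : b ∈ openSegment ℝ ((f y)⁻¹ • y) ((f z)⁻¹ • z) := by
    refine ⟨t * f y / r, (1 - t) * f z / r, by positivity, by positivity, ?_, ?_⟩
    · rw [← add_div, ← hsum, div_self hr0]
    · rw [smul_smul, smul_smul]
      have hbr : b = r⁻¹ • (t • y + (1 - t) • z) := by
        rw [← hxyz, smul_smul, inv_mul_cancel₀ hr0, one_smul]
      rw [hbr, smul_add, smul_smul, smul_smul]
      congr 2 <;> field_simp
  have hyB : (f y)⁻¹ • y ∈ {x | x ∈ K ∧ f x = 1} :=
    ⟨hsmul y hy _ (inv_nonneg.2 hfy.le), by simp [hfy.ne']⟩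
  have hzB : (f z)⁻¹ • z ∈ {x | x ∈ K ∧ f x = 1} :=
    ⟨hsmul z hz _ (inv_nonneg.2 hfz.le), by simp [hfz.ne']⟩
  have hyb := hbext hyB hzB hseg
  have hzb := hbext hzB hyB (by rwa [openSegment_symm])
  refine ⟨⟨f y, hfy.le, ?_⟩, ⟨f z, hfz.le, ?_⟩⟩
  · rw [← hyb, smul_smul, mul_inv_cancel₀ hfy.ne', one_smul]
  · rw [← hzb, smul_smul, mul_inv_cancel₀ hfz.ne', one_smul]

variable [TopologicalSpace E] [T2Space E] [IsTopologicalAddGroup E] [ContinuousSMul ℝ E]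
  [LocallyConvexSpace ℝ E]

open scoped Pointwise in
/-- A nontrivial closed convex cone with a compact base is the closed convex hull of its extreme
rays. -/
theorem closure_convexHull_exr_of_isCompact_base {K : Set E} (hclosed : IsClosed K)
    (hadd : ∀ x ∈ K, ∀ y ∈ K, x + y ∈ K) (hsmul : ∀ x ∈ K, ∀ r : ℝ, 0 ≤ r → r • x ∈ K)
    {f : E →ₗ[ℝ] ℝ} (hf : ∀ x ∈ K, x ≠ 0 → 0 < f x)
    (hcomp : IsCompact {x | x ∈ K ∧ f x = 1}) (hne : ∃ x ∈ K, x ≠ 0) :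
    closure (convexHull ℝ (exr K)) = K := by
  have hconv : Convex ℝ K := fun x hx y hy a b ha hb _ =>
    hadd _ (hsmul x hx a ha) _ (hsmul y hy b hb)
  have hbase : Convex ℝ {x | x ∈ K ∧ f x = 1} :=
    hconv.inter (convex_hyperplane f.isLinear 1)
  have hKM := closure_convexHull_extremePoints hcomp hbase
  have hnormalize : ∀ x ∈ K, x ≠ 0 → (f x)⁻¹ • x ∈ {x | x ∈ K ∧ f x = 1} := fun x hx hx0 =>
    ⟨hsmul x hx _ (inv_nonneg.2 (hf x hx hx0).le), by simp [(hf x hx hx0).ne']⟩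
  apply subset_antisymm
  · refine closure_minimal (convexHull_min ?_ hconv) hclosed
    rintro x ⟨v, hv, r, hr, rfl⟩
    exact hsmul v hv.1 r hr
  · intro x hx
    by_cases hx0 : x = 0
    · obtain ⟨y, hy, hy0⟩ := hne
      obtain ⟨b, hb⟩ := hcomp.extremePoints_nonempty ⟨_, hnormalize y hy hy0⟩
      exact subset_closure (subset_convexHull ℝ _
        ⟨b, isExtremeRayGen_of_mem_extremePoints hsmul hf hb, 0, le_rfl, by simp [hx0]⟩)
    · have hfx := hf x hx hx0
      have hxB := hnormalize x hx hx0
      rw [← hKM] at hxB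
      have hmaps : Set.MapsTo (fun y : E => f x • y)
          (convexHull ℝ ({x | x ∈ K ∧ f x = 1}.extremePoints ℝ)) (convexHull ℝ (exr K)) := by
        intro y hy
        have : f x • y ∈ f x • convexHull ℝ ({x | x ∈ K ∧ f x = 1}.extremePoints ℝ) :=
          Set.smul_mem_smul_set hy
        rw [← convexHull_smul] at this
        refine convexHull_mono ?_ this
        rintro _ ⟨b, hb, rfl⟩
        exact ⟨b, isExtremeRayGen_of_mem_extremePoints hsmul hf hb, f x, hfx.le, rfl⟩
      have := hmaps.closure (continuous_const_smul (f x)) hxB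
      simpa [smul_smul, hfx.ne'] using this

end ConeWithCompactBase

section PosSemidef

theorem posSemidef_real_smul {ι : Type*} {A : Matrix ι ι ℂ} (hA : A.PosSemidef)
    {r : ℝ} (hr : 0 ≤ r) :
    (r • A).PosSemidef :=
  hA.smul hr

theorem isCompact_setOf_norm_apply_le {ι : Type*} (M : ℝ) :
    IsCompact {A : Matrix ι ι ℂ | ∀ i j, ‖A i j‖ ≤ M} := by
  have : {A : Matrix ι ι ℂ | ∀ i j, ‖A i j‖ ≤ M} =
      Set.univ.pi fun _ : ι => Set.univ.pi fun _ : ι => Metric.closedBall (0 : ℂ) M := by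
    ext A
    exact ⟨fun h i _ j _ => mem_closedBall_zero_iff.2 (h i j),
      fun h i j => mem_closedBall_zero_iff.1 (h i trivial j trivial)⟩
  rw [this]
  exact isCompact_univ_pi fun _ => isCompact_univ_pi fun _ => isCompact_closedBall _ _

variable {ι : Type*} [Fintype ι]

theorem re_diag_le_re_trace {A : Matrix ι ι ℂ} (hA : A.PosSemidef) (i : ι) :
    (A i i).re ≤ A.trace.re := by
  rw [Matrix.trace, Complex.re_sum]
  exact Finset.single_le_sum (f := fun j => (A.diag j).re)
    (fun j _ => (Complex.le_def.1 (hA.diag_nonneg (i := j))).1) (Finset.mem_univ i)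

theorem re_trace_nonneg {A : Matrix ι ι ℂ} (hA : A.PosSemidef) : 0 ≤ A.trace.re :=
  (Complex.le_def.1 hA.trace_nonneg).1

/-- The entries of a positive semidefinite matrix are bounded by its trace. -/
theorem norm_apply_le_re_trace {A : Matrix ι ι ℂ} (hA : A.PosSemidef) (i j : ι) :
    ‖A i j‖ ≤ A.trace.re := by
  have hdet := (hA.submatrix ![i, j]).det_nonneg
  rw [Matrix.det_fin_two] at hdet
  simp only [Matrix.submatrix_apply, Matrix.cons_val_zero, Matrix.cons_val_one] at hdet
  have hji : A j i = star (A i j) := (hA.isHermitian.apply j i).symm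
  have hi := Complex.le_def.1 (hA.diag_nonneg (i := i))
  have hj := Complex.le_def.1 (hA.diag_nonneg (i := j))
  have hre := (Complex.le_def.1 hdet).1
  simp only [hji, Complex.star_def, Complex.mul_conj, Complex.sub_re, Complex.mul_re,
    Complex.ofReal_re, Complex.zero_re, Complex.zero_im] at hre hi hj
  rw [← hi.2, Complex.normSq_eq_norm_sq] at hre
  refine abs_le_of_sq_le_sq' ?_ (re_trace_nonneg hA) |>.2
  nlinarith [mul_le_mul (re_diag_le_re_trace hA i) (re_diag_le_re_trace hA j) hj.1
    (re_trace_nonneg hA)]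

theorem eq_zero_of_re_trace_eq_zero {A : Matrix ι ι ℂ} (hA : A.PosSemidef)
    (h : A.trace.re = 0) : A = 0 := by
  ext i j
  exact norm_le_zero_iff.1 (h ▸ norm_apply_le_re_trace hA i j)

theorem isClosed_setOf_posSemidef : IsClosed {A : Matrix ι ι ℂ | A.PosSemidef} := by
  simp only [Matrix.posSemidef_iff_dotProduct_mulVec, Set.ofPred_and, Set.ofPred_forall]
  refine (isClosed_eq (by fun_prop) (by fun_prop)).inter (isClosed_iInter fun v => ?_)
  exact isClosed_Ici.preimage (f := fun A : Matrix ι ι ℂ => star v ⬝ᵥ A.mulVec v) (by fun_prop)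

theorem isCompact_setOf_posSemidef_re_trace_eq_one :
    IsCompact {A : Matrix ι ι ℂ | A.PosSemidef ∧ A.trace.re = 1} :=
  (isCompact_setOf_norm_apply_le 1).of_isClosed_subset
    (isClosed_setOf_posSemidef.inter (isClosed_eq (by fun_prop) (by fun_prop)))
    fun _ hA i j => hA.2 ▸ norm_apply_le_re_trace hA.1 i j

end PosSemidef

/-- A faithful positive functional dominates a positive multiple of the trace. -/
theorem exists_pos_mul_re_trace_le {n : ℕ} {ρ : Matrix (Fin n) (Fin n) ℂ →ₗ[ℂ] ℂ}
    (hρ : IsFaithfulPosLF ρ) :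
    ∃ c : ℝ, 0 < c ∧ ∀ A : Matrix (Fin n) (Fin n) ℂ, A.PosSemidef →
      c * A.trace.re ≤ (ρ A).re := by
  have hρc : Continuous ρ := ρ.continuous_of_finiteDimensional
  have hpos : ∀ A ∈ {A : Matrix (Fin n) (Fin n) ℂ | A.PosSemidef ∧ A.trace.re = 1},
      0 < (ρ A).re := fun A hA =>
    (Complex.lt_def.1 (hρ.2 A hA.1 (by rintro rfl; simpa using hA.2))).1
  obtain ⟨c, hc, hcA⟩ := isCompact_setOf_posSemidef_re_trace_eq_one.exists_forall_le'
    (f := fun A => (ρ A).re) (by fun_prop) (a := 0) hpos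
  refine ⟨c, hc, fun A hA => ?_⟩
  rcases (re_trace_nonneg hA).eq_or_lt with h | h
  · simp [eq_zero_of_re_trace_eq_zero hA h.symm]
  · have hnorm := hcA (A.trace.re⁻¹ • A)
      ⟨posSemidef_real_smul hA (inv_nonneg.2 h.le), by simp [Matrix.trace_smul, h.ne']⟩
    rw [← Complex.coe_smul, map_smul, smul_eq_mul, Complex.re_ofReal_mul,
      ← div_eq_inv_mul, le_div_iff₀ h] at hnorm
    exact hnorm

section Slice

variable {m n l : ℕ} {ρ : Matrix (Fin n) (Fin n) ℂ →ₗ[ℂ] ℂ}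

theorem sliceMap_add (y z : Mat m n (l + 1)) :
    sliceMap ρ (y + z) = sliceMap ρ y + sliceMap ρ z := by
  ext a b
  exact map_add ρ _ _

theorem sliceMap_real_smul (r : ℝ) (y : Mat m n (l + 1)) :
    sliceMap ρ (r • y) = r • sliceMap ρ y := by
  ext a b
  exact ρ.map_smul_of_tower r _

theorem sliceMap_zero : sliceMap ρ (0 : Mat m n (l + 1)) = 0 := by
  ext a b
  exact map_zero ρ

theorem continuous_sliceMap : Continuous (sliceMap ρ : Mat m n (l + 1) → Mat m n l) := by
  have hρc : Continuous ρ := ρ.continuous_of_finiteDimensional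
  refine continuous_matrix fun a b => hρc.comp ?_
  exact continuous_matrix fun s t => continuous_id.matrix_elem _ _

theorem trace_eq_sum_trace_last (y : Mat m n (l + 1)) :
    y.trace = ∑ a : Fin m × (Fin l → Fin n),
      (y.submatrix (fun s => (a.1, Fin.snoc a.2 s))
        (fun s => (a.1, Fin.snoc a.2 s))).trace := by
  simp only [Matrix.trace, Matrix.diag_apply, Matrix.submatrix_apply, Fintype.sum_prod_type]
  refine Finset.sum_congr rfl fun p _ => ?_
  rw [← (Fin.snocEquiv fun _ : Fin (l + 1) => Fin n).sum_comp, Fintype.sum_prod_type,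
    Finset.sum_comm]
  rfl

theorem mul_re_trace_le_re_trace_sliceMap {c : ℝ}
    (hc : ∀ A : Matrix (Fin n) (Fin n) ℂ, A.PosSemidef → c * A.trace.re ≤ (ρ A).re)
    {y : Mat m n (l + 1)} (hy : y.PosSemidef) :
    c * y.trace.re ≤ (sliceMap ρ y).trace.re := by
  rw [trace_eq_sum_trace_last, Complex.re_sum, Finset.mul_sum]
  rw [Matrix.trace, Complex.re_sum]
  exact Finset.sum_le_sum fun a _ => hc _ (hy.submatrix fun s => (a.1, Fin.snoc a.2 s))

end Slice

section Kcone

variable {m n : ℕ} {ρ : Matrix (Fin n) (Fin n) ℂ →ₗ[ℂ] ℂ}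

theorem add_mem_Kcone {x y : ∀ l, Mat m n l} (hx : x ∈ Kcone m n ρ) (hy : y ∈ Kcone m n ρ) :
    x + y ∈ Kcone m n ρ := by
  refine ⟨fun l => (hx.1 l).add (hy.1 l), fun l σ p q i j => ?_, fun l => ?_⟩
  · exact congrArg₂ (· + ·) (hx.2.1 l σ p q i j) (hy.2.1 l σ p q i j)
  · rw [Pi.add_apply, Pi.add_apply, sliceMap_add, add_sub_add_comm]
    exact (hx.2.2 l).add (hy.2.2 l)

theorem smul_mem_Kcone {x : ∀ l, Mat m n l} (hx : x ∈ Kcone m n ρ) {r : ℝ} (hr : 0 ≤ r) :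
    r • x ∈ Kcone m n ρ := by
  refine ⟨fun l => posSemidef_real_smul (hx.1 l) hr, fun l σ p q i j => ?_, fun l => ?_⟩
  · exact congrArg (r • ·) (hx.2.1 l σ p q i j)
  · rw [Pi.smul_apply, Pi.smul_apply, sliceMap_real_smul, ← smul_sub]
    exact posSemidef_real_smul (hx.2.2 l) hr

theorem isClosed_Kcone : IsClosed (Kcone m n ρ) := by
  simp only [Kcone, SymInvariant, Set.ofPred_and, Set.ofPred_forall]
  refine IsClosed.inter ?_ (IsClosed.inter ?_ ?_)
  · exact isClosed_iInter fun l => isClosed_setOf_posSemidef.preimage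
      (f := fun x : ∀ l, Mat m n l => x l) (continuous_apply l)
  · refine isClosed_iInter fun l => isClosed_iInter fun σ => isClosed_iInter fun p =>
      isClosed_iInter fun q => isClosed_iInter fun i => isClosed_iInter fun j =>
        isClosed_eq ?_ ?_
    all_goals exact (continuous_apply l).matrix_elem _ _
  · exact isClosed_iInter fun l => isClosed_setOf_posSemidef.preimage
      ((continuous_apply l).sub (continuous_sliceMap.comp (continuous_apply (l + 1))))

theorem exists_mem_Kcone_ne_zero (hm : 0 < m) : ∃ x ∈ Kcone m n ρ, x ≠ 0 := by
  refine ⟨Pi.single 0 1, ⟨fun l => ?_, fun l σ p q i j => ?_, fun l => ?_⟩, fun h => ?_⟩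
  · cases l with
    | zero => simpa using Matrix.PosSemidef.one
    | succ l => simpa using Matrix.PosSemidef.zero
  · cases l with
    | zero => rw [Subsingleton.elim (i ∘ σ) i, Subsingleton.elim (j ∘ σ) j]
    | succ l => simp
  · rw [Pi.single_eq_of_ne (Nat.succ_ne_zero l), sliceMap_zero, sub_zero]
    cases l with
    | zero => simpa using Matrix.PosSemidef.one
    | succ l => simpa using Matrix.PosSemidef.zero
  · have := congrFun (congrFun (congrFun h 0) (⟨0, hm⟩, Fin.elim0)) (⟨0, hm⟩, Fin.elim0)
    simp at this

theorem re_trace_le_of_mem_Kcone {c : ℝ} (hc : 0 < c)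
    (hcA : ∀ A : Matrix (Fin n) (Fin n) ℂ, A.PosSemidef → c * A.trace.re ≤ (ρ A).re)
    {x : ∀ l, Mat m n l} (hx : x ∈ Kcone m n ρ) (l : ℕ) :
    (x l).trace.re ≤ (x 0).trace.re / c ^ l := by
  induction l with
  | zero => simp
  | succ l ih =>
    have h₁ := mul_re_trace_le_re_trace_sliceMap hcA (hx.1 (l + 1))
    have h₂ := re_trace_nonneg (hx.2.2 l)
    rw [Matrix.trace_sub, Complex.sub_re] at h₂
    rw [le_div_iff₀ (by positivity)] at ih ⊢
    calc (x (l + 1)).trace.re * c ^ (l + 1) = c * (x (l + 1)).trace.re * c ^ l := by ring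
      _ ≤ (x l).trace.re * c ^ l := by gcongr; linarith
      _ ≤ (x 0).trace.re := ih

/-- The trace of the zeroth term of a sequence, as a real linear functional. -/
noncomputable def initialTrace (m n : ℕ) : (∀ l, Mat m n l) →ₗ[ℝ] ℝ :=
  Complex.reLm ∘ₗ Matrix.traceLinearMap (Fin m × (Fin 0 → Fin n)) ℝ ℂ ∘ₗ LinearMap.proj 0

theorem initialTrace_apply (x : ∀ l, Mat m n l) : initialTrace m n x = (x 0).trace.re := rfl

theorem initialTrace_pos (hρ : IsFaithfulPosLF ρ) {x : ∀ l, Mat m n l}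
    (hx : x ∈ Kcone m n ρ) (hx0 : x ≠ 0) : 0 < initialTrace m n x := by
  obtain ⟨c, hc, hcA⟩ := exists_pos_mul_re_trace_le hρ
  refine (re_trace_nonneg (hx.1 0)).lt_of_ne fun h => hx0 (funext fun l => ?_)
  have hle := re_trace_le_of_mem_Kcone hc hcA hx l
  rw [← h, zero_div] at hle
  exact eq_zero_of_re_trace_eq_zero (hx.1 l) (hle.antisymm (re_trace_nonneg (hx.1 l)))

theorem isCompact_Kcone_base (hρ : IsFaithfulPosLF ρ) :
    IsCompact {x | x ∈ Kcone m n ρ ∧ initialTrace m n x = 1} := by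
  obtain ⟨c, hc, hcA⟩ := exists_pos_mul_re_trace_le hρ
  have hbox : IsCompact (Set.univ.pi fun l => {A : Mat m n l | ∀ i j, ‖A i j‖ ≤ 1 / c ^ l}) :=
    isCompact_univ_pi fun l => isCompact_setOf_norm_apply_le _
  refine hbox.of_isClosed_subset (isClosed_Kcone.inter (isClosed_eq ?_ continuous_const)) ?_
  · exact Complex.continuous_re.comp (continuous_apply 0).matrix_trace
  · rintro x ⟨hx, hx1⟩ l - i j
    rw [initialTrace_apply] at hx1
    rw [← hx1]
    exact (norm_apply_le_re_trace (hx.1 l) i j).trans (re_trace_le_of_mem_Kcone hc hcA hx l)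

end Kcone

theorem stmt1 (m n : ℕ) (hm : 0 < m) (hn : 0 < n)
    (ρ : Matrix (Fin n) (Fin n) ℂ →ₗ[ℂ] ℂ) (hρ : IsFaithfulPosLF ρ) :
    closure (convexHull ℝ (exr (Kcone m n ρ))) = Kcone m n ρ := by
  have (l : ℕ) : LocallyConvexSpace ℝ (Mat m n l) :=
    inferInstanceAs (LocallyConvexSpace ℝ
      (Fin m × (Fin l → Fin n) → Fin m × (Fin l → Fin n) → ℂ))
  exact closure_convexHull_exr_of_isCompact_base isClosed_Kcone
    (fun _ hx _ hy => add_mem_Kcone hx hy) (fun _ hx _ hr => smul_mem_Kcone hx hr)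
    (fun _ hx hx0 => initialTrace_pos hρ hx hx0) (isCompact_Kcone_base hρ)
    (exists_mem_Kcone_ne_zero hm)

end DeFinetti
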